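/- arXiv:2009.08806 — 2 statements merged into one kernel-verified Lean document; each statement's English description precedes it below -/
import Mathlib

section
/- Let G be a connected graph on at least two vertices and let uv ∈ E(G). Let H be the graph obtained from G by 4-subdividing the edge uv, that is, by deleting the edge uv and adding four new vertices e_1, e_2, e_3, e_4 together with the edges u e_1, e_1 e_2, e_2 e_3, e_3 e_4, e_4 v. Then γ_t(H) = γ_t(G) + 2. -/
open SimpleGraph

namespace TD

variable {V : Type*} {α β : Type*}

/-- `D` is a total dominating set of `G`: every vertex has a neighbor in `D`. -/
def IsTotalDomSet (G : SimpleGraph V) (D : Set V) : Prop :=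
  ∀ v : V, ∃ u ∈ D, G.Adj v u

/-- The total domination number `γ_t(G)`. -/
noncomputable def totalDomNum (G : SimpleGraph V) : ℕ :=
  sInf {m : ℕ | ∃ D : Set V, IsTotalDomSet G D ∧ D.ncard = m}

/-- A minimum total dominating set. -/
def IsMinTotalDomSet (G : SimpleGraph V) (D : Set V) : Prop :=
  IsTotalDomSet G D ∧ D.ncard = totalDomNum G

/-- `S` contains a `P3`: three distinct vertices `a, b, c ∈ S` with `ab, bc ∈ E(G)`. -/
def HasP3 (G : SimpleGraph V) (S : Set V) : Prop :=
  ∃ a b c : V, a ∈ S ∧ b ∈ S ∧ c ∈ S ∧ a ≠ b ∧ b ≠ c ∧ a ≠ c ∧ G.Adj a b ∧ G.Adj b c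

/-- `D` is a dominating set of `G`. -/
def IsDomSet (G : SimpleGraph V) (D : Set V) : Prop :=
  ∀ v ∉ D, ∃ u ∈ D, G.Adj v u

/-- The domination number `γ(G)`. -/
noncomputable def domNum (G : SimpleGraph V) : ℕ :=
  sInf {m : ℕ | ∃ D : Set V, IsDomSet G D ∧ D.ncard = m}

/-- The (open) neighborhood of a set `S`: union of the neighborhoods of its members. -/
def nbhd (G : SimpleGraph V) (S : Set V) : Set V :=
  {v | ∃ u ∈ S, G.Adj u v}

/-- The closed neighborhood `N[S]`. -/
def closedNbhd (G : SimpleGraph V) (S : Set V) : Set V :=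
  S ∪ nbhd G S

/-- Distance between two sets of vertices. -/
noncomputable def setDist (G : SimpleGraph V) (S T : Set V) : ℕ :=
  sInf {m : ℕ | ∃ u ∈ S, ∃ v ∈ T, G.dist u v = m}

/-- `k` disjoint copies of `H`. -/
def kCopies (k : ℕ) (H : SimpleGraph α) : SimpleGraph (Fin k × α) where
  Adj p q := p.1 = q.1 ∧ H.Adj p.2 q.2
  symm := ⟨fun _ _ h => ⟨h.1.symm, h.2.symm⟩⟩
  loopless := ⟨fun p h => H.loopless.irrefl p.2 h.2⟩

/-- The graph `P4 + k·P3`. -/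
def p4kp3 (k : ℕ) : SimpleGraph (Fin 4 ⊕ (Fin k × Fin 3)) :=
  (pathGraph 4) ⊕g (kCopies k (pathGraph 3))

/-- `G` contains no induced copy of `H` (`G` is `H`-free). -/
def IndFree (G : SimpleGraph V) (H : SimpleGraph α) : Prop :=
  ¬ Nonempty (H ↪g G)

/-- `K` is a maximal clique of the subgraph of `G` induced by `C`. -/
def IsMaxCliqueWithin (G : SimpleGraph V) (C K : Set V) : Prop :=
  K ⊆ C ∧ G.IsClique K ∧ ∀ K' : Set V, K' ⊆ C → G.IsClique K' → K ⊆ K' → K' = K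

/-- Member of `𝒦'`: a maximal clique of `G[C]` whose closed neighborhood contains no
induced `P4` and such that no vertex of `B` is adjacent to all of its vertices. -/
def GoodClique (G : SimpleGraph V) (B C K : Set V) : Prop :=
  IsMaxCliqueWithin G C K ∧
    IndFree (G.induce (closedNbhd G K)) (pathGraph 4) ∧
    ¬ ∃ b ∈ B, ∀ x ∈ K, G.Adj b x

/-- A regular clique: a member of `𝒦'` for which there are `k` other members of `𝒦'`
pairwise at distance at least four from one another and from it. -/
def RegularClique (G : SimpleGraph V) (k : ℕ) (B C K : Set V) : Prop :=
  GoodClique G B C K ∧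
    ∃ Ks : Fin k → Set V,
      (∀ i, GoodClique G B C (Ks i)) ∧
      (∀ i, 4 ≤ setDist G K (Ks i)) ∧
      ∀ i j : Fin k, i ≠ j → 4 ≤ setDist G (Ks i) (Ks j)

/-- `w` is a private neighbor of `v` with respect to `D`: `N(w) ∩ D = {v}`. -/
def IsPrivateNbr (G : SimpleGraph V) (D : Set V) (v w : V) : Prop :=
  {u | u ∈ D ∧ G.Adj w u} = {v}

end TD

open TD SimpleGraph


/-- The adjacency relation of the graph `H` obtained from `G` by 4-subdividing the edge `uv`:
`Sum.inr i` is the new vertex `e_{i+1}`. -/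
def subdivAdj {V : Type*} (G : SimpleGraph V) (u v : V) : V ⊕ Fin 4 → V ⊕ Fin 4 → Prop
  | Sum.inl a, Sum.inl b => G.Adj a b ∧ ¬((a = u ∧ b = v) ∨ (a = v ∧ b = u))
  | Sum.inl a, Sum.inr i => (a = u ∧ i = 0) ∨ (a = v ∧ i = 3)
  | Sum.inr i, Sum.inl a => (a = u ∧ i = 0) ∨ (a = v ∧ i = 3)
  | Sum.inr i, Sum.inr j => (j : ℕ) = (i : ℕ) + 1 ∨ (i : ℕ) = (j : ℕ) + 1

theorem TD.IsTotalDomSet.totalDomNum_le {V : Type*} {G : SimpleGraph V} {D : Set V}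
    (hD : IsTotalDomSet G D) : totalDomNum G ≤ D.ncard :=
  Nat.sInf_le ⟨D, hD, rfl⟩

theorem TD.IsTotalDomSet.exists_isMin {V : Type*} {G : SimpleGraph V} {D : Set V}
    (hD : IsTotalDomSet G D) : ∃ D', IsMinTotalDomSet G D' :=
  Nat.sInf_mem (s := {m | ∃ D, IsTotalDomSet G D ∧ D.ncard = m}) ⟨_, D, hD, rfl⟩

theorem Set.ncard_fin_four (S : Set (Fin 4)) [DecidablePred (· ∈ S)] :
    S.ncard = (if 0 ∈ S then 1 else 0) + (if 1 ∈ S then 1 else 0) +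
      (if 2 ∈ S then 1 else 0) + (if 3 ∈ S then 1 else 0) := by
  have h : S.toFinset = Finset.univ.filter (· ∈ S) := by ext; simp
  rw [Set.ncard_eq_toFinset_card', h, Finset.card_filter, Fin.sum_univ_four]

theorem Set.ncard_eq_preimage_inl_add_preimage_inr {α β : Type*} [Finite α] [Finite β]
    (S : Set (α ⊕ β)) :
    S.ncard = (Sum.inl ⁻¹' S).ncard + (Sum.inr ⁻¹' S).ncard := by
  rw [← Set.ncard_image_of_injective (Sum.inl ⁻¹' S) (Sum.inl_injective (β := β)),
    ← Set.ncard_image_of_injective (Sum.inr ⁻¹' S) (Sum.inr_injective (α := α)),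
    ← Set.ncard_union_eq,
    Set.image_preimage_inl_union_image_preimage_inr]
  exact Set.disjoint_image_inl_image_inr

theorem Set.ncard_setOf_eq_and_le {α : Type*} (a : α) (p : Prop) [Decidable p] :
    {x | x = a ∧ p}.ncard ≤ if p then 1 else 0 := by
  split_ifs with hp <;> simp [hp]

/-- A total dominating set of `G` extends to one of its 4-subdivision with two more vertices. -/
theorem exists_isTotalDomSet_subdiv {V : Type*} [Finite V] {G : SimpleGraph V} {u v : V}
    {H : SimpleGraph (V ⊕ Fin 4)} (hadj : ∀ a b, H.Adj a b ↔ subdivAdj G u v a b)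
    {D : Set V} (hD : IsTotalDomSet G D) :
    ∃ D', IsTotalDomSet H D' ∧ D'.ncard ≤ D.ncard + 2 := by
  classical
  refine ⟨Sum.inl '' D ∪ Sum.inr '' {if u ∈ D then 3 else 1, if v ∈ D then 0 else 2}, ?_, ?_⟩
  · rintro (a | i)
    · obtain ⟨b, hb, hab⟩ := hD a
      by_cases h : (a = u ∧ b = v) ∨ (a = v ∧ b = u)
      · rcases h with ⟨rfl, rfl⟩ | ⟨rfl, rfl⟩
        · exact ⟨Sum.inr 0, by simp [hb], by simp [hadj, subdivAdj]⟩
        · exact ⟨Sum.inr 3, by simp [hb], by simp [hadj, subdivAdj]⟩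
      · exact ⟨Sum.inl b, by simp [hb], (hadj _ _).2 ⟨hab, h⟩⟩
    · fin_cases i
      · by_cases hu : u ∈ D
        · exact ⟨Sum.inl u, by simp [hu], by simp [hadj, subdivAdj]⟩
        · exact ⟨Sum.inr 1, by simp [hu], by simp [hadj, subdivAdj]⟩
      · by_cases hv : v ∈ D
        · exact ⟨Sum.inr 0, by simp [hv], by simp [hadj, subdivAdj]⟩
        · exact ⟨Sum.inr 2, by simp [hv], by simp [hadj, subdivAdj]⟩
      · by_cases hu : u ∈ D
        · exact ⟨Sum.inr 3, by simp [hu], by simp [hadj, subdivAdj]⟩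
        · exact ⟨Sum.inr 1, by simp [hu], by simp [hadj, subdivAdj]⟩
      · by_cases hv : v ∈ D
        · exact ⟨Sum.inl v, by simp [hv], by simp [hadj, subdivAdj]⟩
        · exact ⟨Sum.inr 2, by simp [hv], by simp [hadj, subdivAdj]⟩
  · refine (Set.ncard_union_le _ _).trans (add_le_add ?_ ?_)
    · exact Set.ncard_image_le
    · exact (Set.ncard_image_le (Set.toFinite _)).trans ((Set.ncard_insert_le _ _).trans (by simp))

/-- A total dominating set of the 4-subdivision of an edge of `G` yields one of `G` with two
fewer vertices. -/
theorem exists_isTotalDomSet_of_subdiv {V : Type*} [Finite V] {G : SimpleGraph V} {u v : V}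
    (huv : G.Adj u v) {H : SimpleGraph (V ⊕ Fin 4)}
    (hadj : ∀ a b, H.Adj a b ↔ subdivAdj G u v a b)
    {D' : Set (V ⊕ Fin 4)} (hD' : IsTotalDomSet H D') :
    ∃ D, IsTotalDomSet G D ∧ D.ncard + 2 ≤ D'.ncard := by
  classical
  have h0 : Sum.inl u ∈ D' ∨ Sum.inr 1 ∈ D' := by
    obtain ⟨x | i, hx, hax⟩ := hD' (Sum.inr 0) <;> simp only [hadj, subdivAdj] at hax
    · simp at hax; simp_all
    · fin_cases i <;> simp_all
  have h1 : Sum.inr 0 ∈ D' ∨ Sum.inr 2 ∈ D' := by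
    obtain ⟨x | i, hx, hax⟩ := hD' (Sum.inr 1) <;> simp only [hadj, subdivAdj] at hax
    · simp at hax
    · fin_cases i <;> simp_all
  have h2 : Sum.inr 1 ∈ D' ∨ Sum.inr 3 ∈ D' := by
    obtain ⟨x | i, hx, hax⟩ := hD' (Sum.inr 2) <;> simp only [hadj, subdivAdj] at hax
    · simp at hax
    · fin_cases i <;> simp_all
  have h3 : Sum.inl v ∈ D' ∨ Sum.inr 2 ∈ D' := by
    obtain ⟨x | i, hx, hax⟩ := hD' (Sum.inr 3) <;> simp only [hadj, subdivAdj] at hax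
    · simp at hax; simp_all
    · fin_cases i <;> simp_all
  refine ⟨Sum.inl ⁻¹' D' ∪ {x | x = u ∧ Sum.inr 1 ∈ D' ∧ Sum.inr 3 ∈ D'} ∪
    {x | x = v ∧ Sum.inr 0 ∈ D' ∧ Sum.inr 2 ∈ D'}, ?_, ?_⟩
  · intro a
    obtain ⟨b | i, hb, hab⟩ := hD' (Sum.inl a) <;> simp only [hadj, subdivAdj] at hab
    · exact ⟨b, Or.inl (Or.inl hb), hab.1⟩
    · rcases hab with ⟨rfl, rfl⟩ | ⟨rfl, rfl⟩
      · exact ⟨v, by simp; tauto, huv⟩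
      · exact ⟨u, by simp; tauto, huv.symm⟩
  · have hle := (Set.ncard_union_le (Sum.inl ⁻¹' D' ∪ {x | x = u ∧ Sum.inr 1 ∈ D' ∧ Sum.inr 3 ∈ D'})
      {x | x = v ∧ Sum.inr 0 ∈ D' ∧ Sum.inr 2 ∈ D'}).trans
      (add_le_add_left (Set.ncard_union_le _ _) _)
    have hu := Set.ncard_setOf_eq_and_le u (Sum.inr 1 ∈ D' ∧ Sum.inr 3 ∈ D')
    have hv := Set.ncard_setOf_eq_and_le v (Sum.inr 0 ∈ D' ∧ Sum.inr 2 ∈ D')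
    rw [Set.ncard_eq_preimage_inl_add_preimage_inr D', Set.ncard_fin_four]
    simp only [Set.mem_preimage]
    grind

theorem stmt4 {V : Type*} [Fintype V] (G : SimpleGraph V) (hconn : G.Connected)
    (hcard : 2 ≤ Fintype.card V) (u v : V) (huv : G.Adj u v)
    (H : SimpleGraph (V ⊕ Fin 4))
    (hadj : ∀ a b, H.Adj a b ↔ subdivAdj G u v a b) :
    totalDomNum H = totalDomNum G + 2 := by
  have : Nontrivial V := Fintype.one_lt_card_iff_nontrivial.1 hcard
  have huniv : IsTotalDomSet G Set.univ := fun a =>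
    (hconn.preconnected.exists_adj_of_nontrivial a).imp fun _ h => ⟨Set.mem_univ _, h⟩
  obtain ⟨D, hD, hDcard⟩ := huniv.exists_isMin
  obtain ⟨E, hE, hEcard⟩ := exists_isTotalDomSet_subdiv hadj hD
  obtain ⟨E', hE', hE'card⟩ := hE.exists_isMin
  obtain ⟨F, hF, hFcard⟩ := exists_isTotalDomSet_of_subdiv huv hadj hE'
  have := hE.totalDomNum_le
  have := hF.totalDomNum_le
  omega
end

section
/- Under the (P4+kP3)-free setup, let D be a minimum total dominating set of G and let K be a regular clique. Then |D ∩ N[K]| = 2. -/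
open SimpleGraph

open TD SimpleGraph

namespace TD

variable {V : Type*} {G : SimpleGraph V}

lemma exists_pathGraph_three_embedding {a b c : V} (hab : G.Adj a b) (hbc : G.Adj b c)
    (hac : ¬ G.Adj a c) (hne : a ≠ c) :
    ∃ g : pathGraph 3 ↪g G, ∀ i, g i = ![a, b, c] i := by
  have hab' := hab.ne
  have hbc' := hbc.ne
  refine ⟨⟨⟨![a, b, c], ?_⟩, ?_⟩, fun _ => rfl⟩
  · intro i j
    fin_cases i <;> fin_cases j <;> simp_all [eq_comm]
  · intro i j
    change G.Adj (![a, b, c] i) (![a, b, c] j) ↔ _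
    fin_cases i <;> fin_cases j <;> simp_all [pathGraph_adj, G.adj_comm]

lemma exists_pathGraph_four_embedding {a b c d : V} (hab : G.Adj a b) (hbc : G.Adj b c)
    (hcd : G.Adj c d) (hac : ¬ G.Adj a c) (had : ¬ G.Adj a d) (hbd : ¬ G.Adj b d)
    (hac' : a ≠ c) (had' : a ≠ d) (hbd' : b ≠ d) :
    ∃ f : pathGraph 4 ↪g G, ∀ i, f i = ![a, b, c, d] i := by
  have hab' := hab.ne
  have hbc' := hbc.ne
  have hcd' := hcd.ne
  refine ⟨⟨⟨![a, b, c, d], ?_⟩, ?_⟩, fun _ => rfl⟩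
  · intro i j
    fin_cases i <;> fin_cases j <;> simp_all [eq_comm]
  · intro i j
    change G.Adj (![a, b, c, d] i) (![a, b, c, d] j) ↔ _
    fin_cases i <;> fin_cases j <;> simp_all [pathGraph_adj, G.adj_comm]

lemma nonempty_p4kp3_embedding {k : ℕ} (f : pathGraph 4 ↪g G) (g : Fin k → pathGraph 3 ↪g G)
    (hfg : ∀ a i b, f a ≠ g i b ∧ ¬ G.Adj (f a) (g i b))
    (hgg : ∀ i j, i ≠ j → ∀ a b, g i a ≠ g j b ∧ ¬ G.Adj (g i a) (g j b)) :
    Nonempty (p4kp3 k ↪g G) := by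
  refine ⟨⟨⟨Sum.elim f fun p => g p.1 p.2, ?_⟩, ?_⟩⟩
  · rintro (a | ⟨i, a⟩) (b | ⟨j, b⟩) h
    · simpa using h
    · exact absurd h (hfg a j b).1
    · exact absurd h.symm (hfg b i a).1
    · by_cases hij : i = j
      · subst hij
        simpa using h
      · exact absurd h (hgg i j hij a b).1
  · rintro (a | ⟨i, a⟩) (b | ⟨j, b⟩)
    · change G.Adj (f a) (f b) ↔ _
      simp [p4kp3]
    · change G.Adj (f a) (g j b) ↔ _
      simpa [p4kp3] using (hfg a j b).2
    · change G.Adj (g i a) (f b) ↔ _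
      simpa [p4kp3, G.adj_comm] using (hfg b i a).2
    · change G.Adj (g i a) (g j b) ↔ _
      by_cases hij : i = j
      · subst hij
        simp [p4kp3, kCopies]
      · simpa [p4kp3, kCopies, hij] using (hgg i j hij a b).2

lemma adj_of_adj_of_adj_of_anticomplete {m : ℕ} (hfree : IndFree G (p4kp3 (m + 1))) {A : Set V}
    (e : p4kp3 m ↪g G) (he : ∀ p, e p ∈ A) {a b c : V}
    (ha : a ∉ A ∧ ∀ x ∈ A, ¬ G.Adj a x) (hb : b ∉ A ∧ ∀ x ∈ A, ¬ G.Adj b x)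
    (hc : c ∉ A ∧ ∀ x ∈ A, ¬ G.Adj c x) (hab : G.Adj a b) (hbc : G.Adj b c) (hne : a ≠ c) :
    G.Adj a c := by
  by_contra hac
  obtain ⟨g, hg⟩ := exists_pathGraph_three_embedding hab hbc hac hne
  have hgA : ∀ i, g i ∉ A ∧ ∀ x ∈ A, ¬ G.Adj (g i) x := by
    intro i
    rw [hg]
    fin_cases i
    exacts [ha, hb, hc]
  have key : ∀ i p, e p ≠ g i ∧ ¬ G.Adj (e p) (g i) := fun i p =>
    ⟨fun h => (hgA i).1 (h ▸ he p), fun h => (hgA i).2 _ (he p) h.symm⟩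
  let inP4 : pathGraph 4 ↪g p4kp3 m := ⟨⟨Sum.inl, Sum.inl_injective⟩, by simp [p4kp3]⟩
  let inP3 (i : Fin m) : pathGraph 3 ↪g p4kp3 m :=
    ⟨⟨fun a => Sum.inr (i, a), fun a b h => by simpa using h⟩, fun {a b} => by
      change (p4kp3 m).Adj (Sum.inr (i, a)) (Sum.inr (i, b)) ↔ _
      simp [p4kp3, kCopies]⟩
  refine hfree (nonempty_p4kp3_embedding (inP4.trans e)
    (Fin.cons g fun i => (inP3 i).trans e) ?_ ?_)
  · intro a i b
    refine Fin.cases ?_ (fun i => ?_) i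
    · exact key b _
    · refine ⟨fun h => ?_, fun h => ?_⟩
      · have := e.injective h
        simp [inP4, inP3] at this
      · have := e.map_adj_iff.1 h
        simp [inP4, inP3, p4kp3] at this
  · intro i j
    refine Fin.cases ?_ (fun i => ?_) i <;> refine Fin.cases ?_ (fun j => ?_) j
    · exact fun h => absurd rfl h
    · exact fun _ a b => ⟨(key a _).1.symm, fun h => (key a _).2 h.symm⟩
    · exact fun _ a b => key b _
    · intro hij a b
      have hij' : i ≠ j := fun h => hij (h ▸ rfl)
      refine ⟨fun h => ?_, fun h => ?_⟩
      · have : (Sum.inr (i, a) : Fin 4 ⊕ Fin m × Fin 3) = Sum.inr (j, b) := e.injective h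
        simp [hij'] at this
      · have : (p4kp3 m).Adj (Sum.inr (i, a)) (Sum.inr (j, b)) := e.map_adj_iff.1 h
        simp [p4kp3, kCopies, hij'] at this

lemma le_dist_of_le_setDist {S T : Set V} {n : ℕ} (h : n ≤ setDist G S T) {u v : V}
    (hu : u ∈ S) (hv : v ∈ T) : n ≤ G.dist u v :=
  h.trans (Nat.sInf_le ⟨u, hu, v, hv, rfl⟩)

lemma nonempty_of_pos_setDist {S T : Set V} (h : 0 < setDist G S T) : S.Nonempty ∧ T.Nonempty := by
  obtain ⟨_, u, hu, v, hv, -⟩ := Nat.nonempty_of_pos_sInf h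
  exact ⟨⟨u, hu⟩, ⟨v, hv⟩⟩

lemma exists_dist_le_one_of_mem_closedNbhd {S : Set V} {v : V} (hv : v ∈ closedNbhd G S) :
    ∃ u ∈ S, G.dist u v ≤ 1 := by
  obtain hv | ⟨u, hu, huv⟩ := hv
  · exact ⟨v, hv, by simp⟩
  · exact ⟨u, hu, (dist_eq_one_iff_adj.2 huv).le⟩

lemma two_le_dist_of_mem_closedNbhd (hconn : G.Connected) {S T : Set V}
    (h : 4 ≤ setDist G S T) {p q : V} (hp : p ∈ closedNbhd G S) (hq : q ∈ closedNbhd G T) :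
    2 ≤ G.dist p q := by
  obtain ⟨u, hu, hup⟩ := exists_dist_le_one_of_mem_closedNbhd hp
  obtain ⟨v, hv, hvq⟩ := exists_dist_le_one_of_mem_closedNbhd hq
  have h₁ := le_dist_of_le_setDist h hu hv
  have h₂ := hconn.dist_triangle (u := u) (v := p) (w := v)
  have h₃ := hconn.dist_triangle (u := p) (v := q) (w := v)
  rw [G.dist_comm (u := q)] at h₃
  omega

lemma ne_and_not_adj_of_two_le_dist {p q : V} (h : 2 ≤ G.dist p q) : p ≠ q ∧ ¬ G.Adj p q := by
  refine ⟨?_, fun hpq => ?_⟩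
  · rintro rfl
    simp at h
  · rw [dist_eq_one_iff_adj.2 hpq] at h
    omega

/-- An edge between a clique and its boundary totally dominates the closed neighborhood of the
clique when the boundary vertex has as few neighbors in the clique as possible. -/
lemma exists_adj_dominating_closedNbhd [Finite V] {L : Set V} (hL : G.IsClique L)
    (hP4 : IndFree (G.induce (closedNbhd G L)) (pathGraph 4)) (hne : (nbhd G L \ L).Nonempty) :
    ∃ b ∈ nbhd G L \ L, ∃ l ∈ L, ∀ v ∈ closedNbhd G L, G.Adj v b ∨ G.Adj v l := by
  obtain ⟨b, hb, hmin⟩ := Set.exists_min_image (nbhd G L \ L)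
    (fun b => {x ∈ L | G.Adj b x}.ncard) (Set.toFinite _) hne
  obtain ⟨⟨l, hl, hlb⟩, hbL⟩ := id hb
  refine ⟨b, hb, l, hl, fun v hv => ?_⟩
  by_cases hvL : v ∈ L
  · by_cases hvl : v = l
    · exact .inl (hvl ▸ hlb)
    · exact .inr (hL hvL hl hvl)
  by_cases hvb : v = b
  · exact .inr (hvb ▸ hlb.symm)
  by_contra! hcon
  have hvN : v ∈ nbhd G L := hv.resolve_left hvL
  have hnot : ¬ {x ∈ L | G.Adj v x} ⊆ {x ∈ L | G.Adj b x} := fun hsub =>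
    (hmin v ⟨hvN, hvL⟩).not_gt <| Set.ncard_lt_ncard
      ⟨hsub, fun h => hcon.2 (h ⟨hl, hlb.symm⟩).2⟩
  obtain ⟨m, ⟨hm, hvm⟩, hbm⟩ := Set.not_subset.1 hnot
  have hbm' : ¬ G.Adj b m := fun h => hbm ⟨hm, h⟩
  have hlm : l ≠ m := fun h => hbm' (h ▸ hlb.symm)
  obtain ⟨f, -⟩ := exists_pathGraph_four_embedding (G := G.induce (closedNbhd G L))
    (a := ⟨b, .inr hb.1⟩) (b := ⟨l, .inl hl⟩) (c := ⟨m, .inl hm⟩) (d := ⟨v, hv⟩)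
    hlb.symm (hL hl hm hlm) hvm.symm hbm' (fun h => hcon.1 h.symm) (fun h => hcon.2 h.symm)
    (fun h => hbL (Set.mem_of_eq_of_mem (congrArg Subtype.val h) hm))
    (fun h => hvb (congrArg Subtype.val h).symm)
    (fun h => hvL (Set.mem_of_eq_of_mem (congrArg Subtype.val h).symm hl))
  exact hP4 ⟨f⟩

lemma boundary_nonempty (hconn : G.Connected) {L : Set V} (hL : L.Nonempty)
    {a : V} (ha : a ∉ L) : (nbhd G L \ L).Nonempty := by
  obtain ⟨l, hl⟩ := hL
  obtain ⟨p⟩ := hconn.preconnected l a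
  obtain ⟨d, -, hd₁, hd₂⟩ := p.exists_boundary_dart L hl ha
  exact ⟨d.snd, ⟨d.fst, hd₁, d.adj⟩, hd₂⟩

lemma IsTotalDomSet.exchange {D N : Set V} {b l : V}
    (hN : ∀ v ∈ N, G.Adj v b ∨ G.Adj v l)
    (hout : ∀ v ∉ N, ∃ u ∈ D \ N, G.Adj v u) :
    IsTotalDomSet G (D \ N ∪ {b, l}) := by
  intro v
  by_cases hv : v ∈ N
  · obtain h | h := hN v hv
    · exact ⟨b, by simp, h⟩
    · exact ⟨l, by simp, h⟩
  · obtain ⟨u, hu, huv⟩ := hout v hv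
    exact ⟨u, .inl hu, huv⟩

lemma ncard_exchange_add_le [Finite V] (D N : Set V) (b l : V) :
    (D \ N ∪ {b, l}).ncard + (D ∩ N).ncard ≤ D.ncard + 2 := by
  have h₁ := Set.ncard_union_le (D \ N) {b, l}
  have h₂ : ({b, l} : Set V).ncard ≤ 2 := (Set.ncard_insert_le b {l}).trans (by simp)
  have h₃ := Set.ncard_inter_add_ncard_sdiff_eq_ncard D N
  omega

lemma two_le_ncard_inter_closedNbhd [Finite V] {D L : Set V} (hD : IsTotalDomSet G D)
    (hne : L.Nonempty) (hL : ∀ v ∈ nbhd G L \ L, ∃ x ∈ L, ¬ G.Adj v x) :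
    2 ≤ (D ∩ closedNbhd G L).ncard := by
  have hmem {x u : V} (hx : x ∈ L) (hu : u ∈ D) (h : G.Adj x u) : u ∈ D ∩ closedNbhd G L :=
    ⟨hu, .inr ⟨x, hx, h⟩⟩
  obtain ⟨x, hx⟩ := hne
  obtain ⟨u, hu, hxu⟩ := hD x
  obtain ⟨y, hy, huy⟩ : ∃ y ∈ L, ¬ G.Adj u y := by
    by_cases huL : u ∈ L
    · exact ⟨u, huL, G.loopless.irrefl u⟩
    · exact hL u ⟨⟨x, hx, hxu⟩, huL⟩
  obtain ⟨v, hv, hyv⟩ := hD y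
  exact (Set.one_lt_ncard (Set.toFinite _)).2
    ⟨u, hmem hx hu hxu, v, hmem hy hv hyv, fun h => huy (h ▸ hyv.symm)⟩

end TD

theorem stmt10 {V : Type*} [Fintype V] (k : ℕ) (hk : 1 ≤ k)
    (G : SimpleGraph V) (hconn : G.Connected) (hfree : IndFree G (p4kp3 k))
    (A B C : Set V) (hA : Nonempty (G.induce A ≃g p4kp3 (k - 1)))
    (hB : B = {v | v ∉ A ∧ ∃ a ∈ A, G.Adj v a})
    (hC : C = {v | v ∉ A ∧ v ∉ B})
    (D : Set V) (hD : IsMinTotalDomSet G D)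
    (K : Set V) (hK : RegularClique G k B C K) :
    (D ∩ closedNbhd G K).ncard = 2 := by
  obtain ⟨⟨hDtot, hDmin⟩, hKgood, Ks, hKs, hKKs, hKsKs⟩ := And.intro hD hK
  obtain ⟨m, rfl⟩ : ∃ m, k = m + 1 := ⟨k - 1, by omega⟩
  obtain ⟨φ⟩ := hA
  let e : p4kp3 m ↪g G := φ.symm.toEmbedding.trans (Embedding.induce A)
  have he : ∀ p, e p ∈ A := fun p => (φ.symm p).2
  have hCA : ∀ c ∈ C, c ∉ A ∧ ∀ x ∈ A, ¬ G.Adj c x := by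
    subst hB hC
    exact fun c hc => ⟨hc.1, fun x hx h => hc.2 ⟨hc.1, x, hx, h⟩⟩
  have hboundary : ∀ L, GoodClique G B C L → ∀ v ∈ nbhd G L \ L, ∃ x ∈ L, ¬ G.Adj v x := by
    rintro L ⟨⟨hLC, hLcl, hLmax⟩, -, hLB⟩ v ⟨⟨u, hu, huv⟩, hvL⟩
    by_contra! hall
    have hvA : v ∉ A := fun hvA => (hCA u (hLC hu)).2 v hvA huv
    have hvB : v ∉ B := fun hvB => hLB ⟨v, hvB, hall⟩
    have hvC : v ∈ C := hC ▸ ⟨hvA, hvB⟩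
    have := hLmax (insert v L) (Set.insert_subset hvC hLC)
      (hLcl.insert fun x hx _ => hall x hx) (Set.subset_insert v L)
    exact hvL (this ▸ Set.mem_insert v L)
  have hmin : ∀ D', IsTotalDomSet G D' → D.ncard ≤ D'.ncard := fun D' hD' =>
    hDmin ▸ Nat.sInf_le ⟨D', hD', rfl⟩
  have hne : ∀ i, (Ks i).Nonempty := fun i =>
    (nonempty_of_pos_setDist (by linarith [hKKs i] : 0 < setDist G K (Ks i))).2
  have hKne : K.Nonempty := (nonempty_of_pos_setDist (by linarith [hKKs 0])).1
  have hbdne : ∀ L, GoodClique G B C L → L.Nonempty → (nbhd G L \ L).Nonempty := fun L hL hLne =>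
    boundary_nonempty hconn hLne fun h => (hCA _ (hL.1.1 h)).1 (he (.inl 0))
  have hdom : ∀ L, GoodClique G B C L → L.Nonempty → ∃ b ∈ nbhd G L \ L, ∃ l ∈ L,
      ∀ v ∈ closedNbhd G L, G.Adj v b ∨ G.Adj v l := fun L hL hLne =>
    exists_adj_dominating_closedNbhd hL.1.2.1 hL.2.1 (hbdne L hL hLne)
  -- a vertex outside `N[K]` with a neighbor on the boundary of `K` is complete to the boundary
  -- of one of the distant cliques
  have hcomplete : ∀ w ∉ closedNbhd G K, ∀ d ∈ nbhd G K \ K, G.Adj w d →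
      ∃ i, ∀ b ∈ nbhd G (Ks i) \ Ks i, G.Adj w b := by
    intro w hw d hd hwd
    by_contra! hcon
    choose b hb hwb using hcon
    choose y hy hby using fun i => hboundary _ (hKs i) (b i) (hb i)
    choose x hx hxb using fun i => (hb i).1
    have hxy : ∀ i, G.Adj (x i) (y i) := fun i =>
      (hKs i).1.2.1 (hx i) (hy i) fun h => hby i (h ▸ (hxb i).symm)
    choose g hg using fun i => exists_pathGraph_three_embedding (hxb i).symm (hxy i) (hby i)
      fun h => (hb i).2 (h ▸ hy i)
    obtain ⟨z, hz, hdz⟩ := hboundary K hKgood d hd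
    obtain ⟨u, hu, hud⟩ := hd.1
    have hwK : ∀ v ∈ K, ¬ G.Adj w v := fun v hv h => hw (.inr ⟨v, hv, h.symm⟩)
    have hwK' : ∀ v ∈ K, w ≠ v := fun v hv h => hw (.inl (h ▸ hv))
    obtain ⟨f, hf⟩ := exists_pathGraph_four_embedding hwd hud.symm
      (hKgood.1.2.1 hu hz fun h => hdz (h ▸ hud.symm)) (hwK u hu) (hwK z hz) hdz
      (hwK' u hu) (hwK' z hz) fun h => hd.2 (h ▸ hz)
    have hgmem : ∀ i a, g i a ∈ closedNbhd G (Ks i) := by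
      intro i a
      rw [hg]
      fin_cases a
      exacts [.inr (hb i).1, .inl (hx i), .inl (hy i)]
    have hwL : ∀ i, ∀ v ∈ Ks i, w ≠ v ∧ ¬ G.Adj w v := by
      intro i v hv
      have h₁ := le_dist_of_le_setDist (hKKs i) hu hv
      have h₂ := hconn.dist_triangle (u := u) (v := d) (w := w)
      have h₃ := hconn.dist_triangle (u := u) (v := w) (w := v)
      rw [dist_eq_one_iff_adj.2 hud, dist_eq_one_iff_adj.2 hwd.symm] at h₂
      exact ne_and_not_adj_of_two_le_dist (by omega)
    refine hfree (nonempty_p4kp3_embedding f g ?_ fun i j hij a c =>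
      ne_and_not_adj_of_two_le_dist
        (two_le_dist_of_mem_closedNbhd hconn (hKsKs i j hij) (hgmem i a) (hgmem j c)))
    intro a i c
    have hfar : ∀ p ∈ closedNbhd G K, p ≠ g i c ∧ ¬ G.Adj p (g i c) := fun p hp =>
      ne_and_not_adj_of_two_le_dist
        (two_le_dist_of_mem_closedNbhd hconn (hKKs i) hp (hgmem i c))
    rw [hf]
    fin_cases a
    · change w ≠ _ ∧ ¬ G.Adj w _
      rw [hg]
      fin_cases c
      · exact ⟨fun h => (hwL i _ (hx i)).2 (h ▸ (hxb i).symm), hwb i⟩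
      · exact hwL i _ (hx i)
      · exact hwL i _ (hy i)
    · exact hfar d (.inr hd.1)
    · exact hfar u (.inl hu)
    · exact hfar z (.inl hz)
  have hdisj : ∀ {S T : Set V}, 4 ≤ setDist G S T →
      ∀ p ∈ closedNbhd G S, p ∉ closedNbhd G T := fun h p hp hq =>
    (ne_and_not_adj_of_two_le_dist (two_le_dist_of_mem_closedNbhd hconn h hp hq)).1 rfl
  -- exchange inside the distant cliques, one at a time
  have hexch : ∀ s : Finset (Fin (m + 1)), ∃ D', IsTotalDomSet G D' ∧ D'.ncard ≤ D.ncard ∧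
      D' ∩ closedNbhd G K = D ∩ closedNbhd G K ∧
      ∀ i ∈ s, (D' ∩ (nbhd G (Ks i) \ Ks i)).Nonempty := by
    intro s
    induction s using Finset.induction_on with
    | empty => exact ⟨D, hDtot, le_rfl, rfl, by simp⟩
    | insert i s _ ih =>
      obtain ⟨D', hD', hcard, hDK, hs⟩ := ih
      by_cases hi : (D' ∩ (nbhd G (Ks i) \ Ks i)).Nonempty
      · exact ⟨D', hD', hcard, hDK, by simpa using ⟨hi, hs⟩⟩
      obtain ⟨b, hb, l, hl, hbl⟩ := hdom _ (hKs i) (hne i)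
      have h₂ := two_le_ncard_inter_closedNbhd hD' (hne i) (hboundary _ (hKs i))
      have h₃ := ncard_exchange_add_le D' (closedNbhd G (Ks i)) b l
      refine ⟨D' \ closedNbhd G (Ks i) ∪ {b, l}, IsTotalDomSet.exchange hbl ?_, by omega, ?_, ?_⟩
      · intro v hv
        obtain ⟨u, hu, hvu⟩ := hD' v
        refine ⟨u, ⟨hu, fun huN => ?_⟩, hvu⟩
        by_cases huL : u ∈ Ks i
        · exact hv (.inr ⟨u, huL, hvu.symm⟩)
        · exact hi ⟨u, hu, huN.resolve_left huL, huL⟩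
      · rw [← hDK]
        have hbK : b ∉ closedNbhd G K := fun h => hdisj (hKKs i) b h (.inr hb.1)
        have hlK : l ∉ closedNbhd G K := fun h => hdisj (hKKs i) l h (.inl hl)
        ext v
        constructor
        · rintro ⟨hv | rfl | rfl, hvK⟩
          · exact ⟨hv.1, hvK⟩
          · exact absurd hvK hbK
          · exact absurd hvK hlK
        · exact fun ⟨hv, hvK⟩ => ⟨.inl ⟨hv, hdisj (hKKs i) v hvK⟩, hvK⟩
      · intro j hj
        by_cases hij : j = i
        · subst hij
          exact ⟨b, .inr (.inl rfl), hb⟩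
        · obtain ⟨v, hv, hvj⟩ := hs j ((Finset.mem_insert.1 hj).resolve_left hij)
          exact ⟨v, .inl ⟨hv, hdisj (hKsKs j i hij) v (.inr hvj.1)⟩, hvj⟩
  obtain ⟨D', hD', hcard, hDK, hall⟩ := hexch Finset.univ
  obtain ⟨b, hb, l, hl, hbl⟩ := hdom K hKgood hKne
  have hle := hmin _ <| IsTotalDomSet.exchange (D := D') hbl <| by
    intro v hv
    obtain ⟨u, hu, hvu⟩ := hD' v
    by_cases huN : u ∈ closedNbhd G K
    · have huK : u ∉ K := fun h => hv (.inr ⟨u, h, hvu.symm⟩)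
      obtain ⟨i, hi⟩ := hcomplete v hv u ⟨huN.resolve_left huK, huK⟩ hvu
      obtain ⟨c, hc, hci⟩ := hall i (Finset.mem_univ i)
      exact ⟨c, ⟨hc, fun h => hdisj (hKKs i) c h (.inr hci.1)⟩, hi c hci⟩
    · exact ⟨u, ⟨hu, huN⟩, hvu⟩
  have hcount := ncard_exchange_add_le D' (closedNbhd G K) b l
  have hge := two_le_ncard_inter_closedNbhd hDtot hKne (hboundary K hKgood)
  rw [hDK] at hcount
  omega
end
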